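/- The serial joint transition probabilities σ_t(m′, m) = P(S_{t−1} = m′, S_t = m, Y = y) and the parallel joint transition probabilities σ_t^P(m′, m) = P(S_{t−1} = m′, S_t = m, Y_{i(t)} = y|_{i(t)}) differ exactly by the ratio of the observation probabilities: for every t ∈ {1,…,L}, every pair of states m′, m ∈ S, and every observation sequence y with P(Y = y) > 0, one has σ_t(m′, m) = (P(Y = y) / P(Y_{i(t)} = y|_{i(t)})) · σ_t^P(m′, m). -/

import Mathlib

/-!
Finite hidden Markov source over a memoryless channel.
States `S` (with distinguished state `0`), channel output symbols `O`.
A state path is `s : Fin (L+1) → S`; an observation sequence is `y : Fin L → O`,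
where index `t : Fin L` represents time `t+1 ∈ {1,…,L}`.
-/

open scoped Classical in
/-- The probability of an event `A` under the mass function `P`. -/
noncomputable def prob {S O : Type*} [Fintype S] [Fintype O] {L : ℕ}
    (P : (Fin (L + 1) → S) × (Fin L → O) → ℝ)
    (A : (Fin (L + 1) → S) × (Fin L → O) → Prop) : ℝ :=
  ∑ sy : (Fin (L + 1) → S) × (Fin L → O), if A sy then P sy else 0

/-- The conditional probability `P(A | B)`. -/
noncomputable def condProb {S O : Type*} [Fintype S] [Fintype O] {L : ℕ}
    (P : (Fin (L + 1) → S) × (Fin L → O) → ℝ)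
    (A B : (Fin (L + 1) → S) × (Fin L → O) → Prop) : ℝ :=
  prob P (fun sy => A sy ∧ B sy) / prob P B

open scoped Classical in
/-- Replace the states and observations of `w` at the times in `I` and `J` by those of `v`. -/
noncomputable def splice {S O : Type*} {L : ℕ} (I : Set (Fin (L + 1))) (J : Set (Fin L))
    (w v : (Fin (L + 1) → S) × (Fin L → O)) : (Fin (L + 1) → S) × (Fin L → O) :=
  (I.piecewise v.1 w.1, J.piecewise v.2 w.2)

theorem splice_splice {S O : Type*} {L : ℕ} (I : Set (Fin (L + 1))) (J : Set (Fin L))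
    (w v : (Fin (L + 1) → S) × (Fin L → O)) :
    splice I J (splice I J w v) (splice I J v w) = w := by
  ext k
  · by_cases h : k ∈ I <;> simp [splice, h]
  · by_cases h : k ∈ J <;> simp [splice, h]

/-- Exchange the states in `I` and the observations in `J` between two outcomes. -/
noncomputable def exchange {S O : Type*} {L : ℕ} (I : Set (Fin (L + 1))) (J : Set (Fin L)) :
    Equiv.Perm (((Fin (L + 1) → S) × (Fin L → O)) × ((Fin (L + 1) → S) × (Fin L → O))) :=
  Function.Involutive.toPerm (fun z => (splice I J z.1 z.2, splice I J z.2 z.1))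
    fun z => by simp [splice_splice]

theorem exchange_apply {S O : Type*} {L : ℕ} (I : Set (Fin (L + 1))) (J : Set (Fin L))
    (z : ((Fin (L + 1) → S) × (Fin L → O)) × ((Fin (L + 1) → S) × (Fin L → O))) :
    exchange I J z = (splice I J z.1 z.2, splice I J z.2 z.1) := rfl

theorem prob_mono {S O : Type*} [Fintype S] [Fintype O] {L : ℕ}
    {P : (Fin (L + 1) → S) × (Fin L → O) → ℝ} (hP : ∀ w, 0 ≤ P w)
    {A B : (Fin (L + 1) → S) × (Fin L → O) → Prop} (h : ∀ w, A w → B w) :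
    prob P A ≤ prob P B := by
  refine Finset.sum_le_sum fun w _ => ?_
  by_cases hA : A w
  · simp [hA, h w hA]
  · simp only [hA, if_false]
    split_ifs <;> simp [hP]

theorem prob_mul_prob_eq_of_perm {S O : Type*} [Fintype S] [Fintype O] {L : ℕ}
    {P : (Fin (L + 1) → S) × (Fin L → O) → ℝ}
    {A B C D : (Fin (L + 1) → S) × (Fin L → O) → Prop}
    (e : Equiv.Perm (((Fin (L + 1) → S) × (Fin L → O)) × ((Fin (L + 1) → S) × (Fin L → O))))
    (hP : ∀ z, P (e z).1 * P (e z).2 = P z.1 * P z.2)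
    (hE : ∀ z, A z.1 ∧ B z.2 ↔ C (e z).1 ∧ D (e z).2) :
    prob P A * prob P B = prob P C * prob P D := by
  classical
  unfold prob
  rw [Fintype.sum_mul_sum, Fintype.sum_mul_sum, ← Fintype.sum_prod_type',
    ← Fintype.sum_prod_type']
  refine Fintype.sum_equiv e _ _ fun z => ?_
  simp only [ite_zero_mul_ite_zero, hE, hP]

/-- Exchanging a segment between two paths that agree at both of its ends preserves the
product of their path weights. -/
theorem prod_splice_mul_prod_splice {S O : Type*} {L : ℕ} (f : O → S → S → ℝ)
    {a b : Fin (L + 1)} {w v : (Fin (L + 1) → S) × (Fin L → O)}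
    (ha : w.1 a = v.1 a) (hb : w.1 b = v.1 b) :
    let I := Set.Icc a b
    let J := {k : Fin L | a ≤ k.castSucc ∧ k.succ ≤ b}
    (∏ k, f ((splice I J w v).2 k) ((splice I J w v).1 k.castSucc) ((splice I J w v).1 k.succ)) *
      (∏ k, f ((splice I J v w).2 k) ((splice I J v w).1 k.castSucc) ((splice I J v w).1 k.succ)) =
    (∏ k, f (w.2 k) (w.1 k.castSucc) (w.1 k.succ)) *
      ∏ k, f (v.2 k) (v.1 k.castSucc) (v.1 k.succ) := by
  intro I J
  rw [← Finset.prod_mul_distrib, ← Finset.prod_mul_distrib]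
  refine Finset.prod_congr rfl fun k _ => ?_
  by_cases hk : k ∈ J
  · have h₁ : k.castSucc ∈ I := ⟨hk.1, k.castSucc_lt_succ.le.trans hk.2⟩
    have h₂ : k.succ ∈ I := ⟨hk.1.trans k.castSucc_lt_succ.le, hk.2⟩
    simp [splice, hk, h₁, h₂, mul_comm]
  · have key : ∀ l, l = k.castSucc ∨ l = k.succ → l ∈ I → w.1 l = v.1 l := by
      intro l hl hI
      have : l = a ∨ l = b := by
        simp only [J, I, Set.mem_ofPred_eq, Set.mem_Icc, Fin.le_def, Fin.ext_iff,
          Fin.val_castSucc, Fin.val_succ] at *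
        omega
      rcases this with rfl | rfl <;> assumption
    have eq : ∀ l, l = k.castSucc ∨ l = k.succ →
        (splice I J w v).1 l = w.1 l ∧ (splice I J v w).1 l = v.1 l := by
      intro l hl
      by_cases hI : l ∈ I
      · simp [splice, hI, key l hl hI]
      · simp [splice, hI]
    rw [(eq _ (.inl rfl)).1, (eq _ (.inl rfl)).2, (eq _ (.inr rfl)).1, (eq _ (.inr rfl)).2]
    simp [splice, hk]

/-- For a factorizing mass function whose paths return to `0` at both ends of a segment,
exchanging that segment between two outcomes preserves the product mass. -/
theorem mul_splice_eq_mul {S O : Type*} [Zero S] [DecidableEq S] {L : ℕ} {f : O → S → S → ℝ}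
    {P : (Fin (L + 1) → S) × (Fin L → O) → ℝ}
    (hP : ∀ s y, P (s, y) =
      (if s 0 = 0 then (1 : ℝ) else 0) * ∏ k : Fin L, f (y k) (s k.castSucc) (s k.succ))
    {a b : Fin (L + 1)} (hab : a ≤ b) (hterm : ∀ w, P w ≠ 0 → w.1 a = 0 ∧ w.1 b = 0)
    (w v : (Fin (L + 1) → S) × (Fin L → O)) :
    let I := Set.Icc a b
    let J := {k : Fin L | a ≤ k.castSucc ∧ k.succ ≤ b}
    P (splice I J w v) * P (splice I J v w) = P w * P v := by
  intro I J
  by_cases h : (w.1 a = 0 ∧ w.1 b = 0) ∧ v.1 a = 0 ∧ v.1 b = 0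
  · obtain ⟨⟨hwa, hwb⟩, hva, hvb⟩ := h
    have hprod := prod_splice_mul_prod_splice f (hwa.trans hva.symm) (hwb.trans hvb.symm)
    have hP' : ∀ u, P u = (if u.1 0 = 0 then (1 : ℝ) else 0) *
        ∏ k : Fin L, f (u.2 k) (u.1 k.castSucc) (u.1 k.succ) := fun u => hP u.1 u.2
    have hinit : ((if (splice I J w v).1 0 = 0 then (1 : ℝ) else 0) *
        if (splice I J v w).1 0 = 0 then (1 : ℝ) else 0) =
        (if w.1 0 = 0 then (1 : ℝ) else 0) * if v.1 0 = 0 then (1 : ℝ) else 0 := by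
      by_cases h0 : (0 : Fin (L + 1)) ∈ I
      · simp only [splice, h0, Set.piecewise_eq_of_mem]
        exact mul_comm _ _
      · simp only [splice, h0, not_false_eq_true, Set.piecewise_eq_of_notMem]
    rw [hP', hP', hP' w, hP' v, mul_mul_mul_comm]
    exact (congrArg₂ (· * ·) hinit hprod).trans (mul_mul_mul_comm _ _ _ _)
  · have haI : a ∈ I := ⟨le_rfl, hab⟩
    have hbI : b ∈ I := ⟨hab, le_rfl⟩
    rw [show P w * P v = 0 by
      by_contra h0
      exact h ⟨hterm w (left_ne_zero_of_mul h0), hterm v (right_ne_zero_of_mul h0)⟩]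
    by_contra h0
    have h₁ := hterm _ (left_ne_zero_of_mul h0)
    have h₂ := hterm _ (right_ne_zero_of_mul h0)
    simp only [splice, haI, hbI, Set.piecewise_eq_of_mem] at h₁ h₂
    exact h ⟨h₂, h₁⟩

/-- **Serial and parallel joint transition/observation probabilities differ exactly by
the ratio of the observation probabilities:**
`σ_t(m', m) = (P(Y = y) / P(Y_{i(t)} = y|_{i(t)})) · σ_t^P(m', m)`. -/
theorem serial_parallel_sigma_ratio
    {S O : Type*} [Fintype S] [Fintype O] [Nonempty S] [Nonempty O]
    [Zero S] [DecidableEq S]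
    {N L : ℕ} (hN : 1 ≤ N) (hL : 1 ≤ L)
    -- boundary times 0 = L_0 < L_1 < ⋯ < L_N = L
    (Lb : Fin (N + 1) → Fin (L + 1)) (hmono : StrictMono Lb)
    (hLb0 : Lb 0 = 0) (hLbN : Lb (Fin.last N) = Fin.last L)
    -- the factorizing probability mass function
    (p : S → S → ℝ) (q : O → S → S → ℝ)
    (hp : ∀ a b, 0 ≤ p a b) (hq : ∀ o a b, 0 ≤ q o a b)
    (P : (Fin (L + 1) → S) × (Fin L → O) → ℝ)
    (hP : ∀ s y, P (s, y) =
      (if s 0 = 0 then (1 : ℝ) else 0) *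
        ∏ t : Fin L, p (s t.castSucc) (s t.succ) * q (y t) (s t.castSucc) (s t.succ))
    (hsum : ∑ sy : (Fin (L + 1) → S) × (Fin L → O), P sy = 1)
    -- termination: each parallel codeword drives the encoder back to state 0
    (hterm : ∀ s y, P (s, y) ≠ 0 → ∀ i : Fin (N + 1), s (Lb i) = 0)
    -- the pair of states
    (m' m : S)
    -- the observation sequence, with positive serial probability
    (y : Fin L → O)
    (hy : 0 < prob P (fun sy => sy.2 = y))
    -- the time t (as an element of Fin L, representing time t+1) and its segment index
    (t : Fin L) (i : Fin N)
    (hti : ((Lb i.castSucc : ℕ) < (t : ℕ) + 1) ∧ ((t : ℕ) + 1 ≤ (Lb i.succ : ℕ))) :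
    prob P (fun sy => (sy.1 t.castSucc = m' ∧ sy.1 t.succ = m) ∧ sy.2 = y) =
      (prob P (fun sy => sy.2 = y) /
        prob P (fun sy => ∀ k : Fin L,
          (Lb i.castSucc : ℕ) < (k : ℕ) + 1 → (k : ℕ) + 1 ≤ (Lb i.succ : ℕ) →
            sy.2 k = y k)) *
      prob P (fun sy => (sy.1 t.castSucc = m' ∧ sy.1 t.succ = m) ∧
        ∀ k : Fin L,
          (Lb i.castSucc : ℕ) < (k : ℕ) + 1 → (k : ℕ) + 1 ≤ (Lb i.succ : ℕ) →
            sy.2 k = y k) := by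
  set J : Set (Fin L) := {k | Lb i.castSucc ≤ k.castSucc ∧ k.succ ≤ Lb i.succ} with hJ
  set I : Set (Fin (L + 1)) := Set.Icc (Lb i.castSucc) (Lb i.succ) with hI
  have mem_J : ∀ k : Fin L, k ∈ J ↔
      (Lb i.castSucc : ℕ) < (k : ℕ) + 1 ∧ (k : ℕ) + 1 ≤ (Lb i.succ : ℕ) := fun k => by
    simp [hJ, Fin.le_def]
  simp only [← and_imp, ← mem_J] at hti ⊢
  have ht₁ : t.castSucc ∈ I := ⟨hti.1, t.castSucc_lt_succ.le.trans hti.2⟩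
  have ht₂ : t.succ ∈ I := ⟨hti.1.trans t.castSucc_lt_succ.le, hti.2⟩
  have hP0 : ∀ w, 0 ≤ P w := fun w => by
    rw [← Prod.mk.eta (p := w), hP]
    refine mul_nonneg (by split_ifs <;> simp) (Finset.prod_nonneg fun k _ => ?_)
    exact mul_nonneg (hp _ _) (hq _ _ _)
  have hpos : 0 < prob P (fun sy => ∀ k ∈ J, sy.2 k = y k) :=
    hy.trans_le (prob_mono hP0 fun w hw k _ => congrFun hw k)
  rw [div_mul_eq_mul_div, eq_div_iff hpos.ne']
  refine prob_mul_prob_eq_of_perm (exchange I J) (fun z => ?_) fun z => ?_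
  · exact mul_splice_eq_mul (f := fun o a b => p a b * q o a b) hP
      (hmono i.castSucc_lt_succ).le (fun w hw => ⟨hterm w.1 w.2 hw _, hterm w.1 w.2 hw _⟩) z.1 z.2
  · simp only [exchange_apply, splice, ht₁, ht₂, Set.piecewise_eq_of_mem, funext_iff]
    constructor
    · rintro ⟨⟨hs, hz⟩, hz'⟩
      refine ⟨fun k => ?_, hs, fun k hk => by simp [hk, hz]⟩
      by_cases hk : k ∈ J <;> simp [hk, hz, hz']
    · rintro ⟨hz, hs, hz'⟩
      refine ⟨⟨hs, fun k => ?_⟩, fun k hk => by simpa [hk] using hz k⟩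
      by_cases hk : k ∈ J
      · simpa [hk] using hz' k hk
      · simpa [hk] using hz k
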